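/- Fix a positive integer ε. A quintuple P = (a,b,c,d,ε) of positive integers can be obtained from (ε,ε,ε,ε,ε) by a finite composition of α, β, α⁻¹, β⁻¹ if and only if T(P) = 0, all three components of φ(P) are positive integers, and ε divides a, b, c, d. That is, G(ε,ε,ε,ε,ε) = { P = (a,b,c,d,ε) ∈ ℕ₊⁵ : T(P) = 0, φ(P) ∈ ℕ₊³, and every component of P is divisible by ε }. -/

import Mathlib

abbrev Q5 := ℚ × ℚ × ℚ × ℚ × ℚ

/-- α(a,b,c,d,e) = (b, (b²+cd)/a, c, d, e) -/
def actAlpha : Q5 → Q5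
  | (a, b, c, d, e) => (b, (b ^ 2 + c * d) / a, c, d, e)

/-- β(a,b,c,d,e) = (b, c, (ac+be)/d, a, e) -/
def actBeta : Q5 → Q5
  | (a, b, c, d, e) => (b, c, (a * c + b * e) / d, a, e)

/-- α⁻¹(a,b,c,d,e) = ((a²+cd)/b, a, c, d, e) -/
def actAlphaInv : Q5 → Q5
  | (a, b, c, d, e) => ((a ^ 2 + c * d) / b, a, c, d, e)

/-- β⁻¹(a,b,c,d,e) = (d, a, b, (ae+bd)/c, e) -/
def actBetaInv : Q5 → Q5
  | (a, b, c, d, e) => (d, a, b, (a * e + b * d) / c, e)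

/-- Generators of the group G. -/
inductive Gen | A | B | Ainv | Binv

def Gen.app : Gen → Q5 → Q5
  | .A => actAlpha
  | .B => actBeta
  | .Ainv => actAlphaInv
  | .Binv => actBetaInv

/-- An element of G, given as a word in the generators, applied to a quintuple. -/
def applyWord (w : List Gen) (P : Q5) : Q5 := w.foldl (fun Q g => g.app Q) P

def Pos5 : Q5 → Prop
  | (a, b, c, d, e) => 0 < a ∧ 0 < b ∧ 0 < c ∧ 0 < d ∧ 0 < e
def T : Q5 → ℚ
  | (a, b, c, d, e) =>
      (a * b * (c ^ 2 + d ^ 2 + e ^ 2) + (a ^ 2 + b ^ 2 + c * d) * (c + d) * e) /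
        (a * b * c * d) - 9
def phiC0 : Q5 → ℚ
  | (a, b, c, d, _) => (a ^ 2 + b ^ 2 + c * d) / (a * b)

def phiC1 : Q5 → ℚ
  | (a, b, c, d, e) => (c ^ 2 * d + a ^ 2 * c + b ^ 2 * d + a * b * e) / (b * c * d)

def phiC2 : Q5 → ℚ
  | (a, b, c, d, e) => (c * d ^ 2 + a ^ 2 * c + b ^ 2 * d + a * b * e) / (a * c * d)

def phi (P : Q5) : ℚ × ℚ × ℚ := (phiC0 P, phiC1 P, phiC2 P)

/-- `q` is a positive integer. -/
def IsPosInt (q : ℚ) : Prop := ∃ k : ℕ, 0 < k ∧ q = (k : ℚ)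

/-- Integer form of the arithmetic conditions on `(a, b, c, d, e)`, where `(x, y, z)` is the
value of `phi`. -/
structure IsAdmissible (e a b c d x y z : ℤ) : Prop where
  a_pos : 0 < a
  b_pos : 0 < b
  c_pos : 0 < c
  d_pos : 0 < d
  x_pos : 0 < x
  y_pos : 0 < y
  z_pos : 0 < z
  dvd_a : e ∣ a
  dvd_b : e ∣ b
  dvd_c : e ∣ c
  dvd_d : e ∣ d
  eq_x : a ^ 2 + b ^ 2 + c * d = x * (a * b)
  eq_y : c ^ 2 * d + a ^ 2 * c + b ^ 2 * d + a * b * e = y * (b * c * d)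
  eq_z : c * d ^ 2 + a ^ 2 * c + b ^ 2 * d + a * b * e = z * (a * c * d)
  markov : x ^ 2 + y ^ 2 + z ^ 2 + 7 = x * y * z

namespace IsAdmissible

variable {e a b c d x y z : ℤ}

/-- The mirror symmetry, which conjugates each generator to its inverse. -/
theorem mirror (h : IsAdmissible e a b c d x y z) : IsAdmissible e b a d c x z y where
  a_pos := h.b_pos
  b_pos := h.a_pos
  c_pos := h.d_pos
  d_pos := h.c_pos
  x_pos := h.x_pos
  y_pos := h.z_pos
  z_pos := h.y_pos
  dvd_a := h.dvd_b
  dvd_b := h.dvd_a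
  dvd_c := h.dvd_d
  dvd_d := h.dvd_c
  eq_x := by linear_combination h.eq_x
  eq_y := by linear_combination h.eq_z
  eq_z := by linear_combination h.eq_y
  markov := by linear_combination h.markov

theorem alpha_mul (h : IsAdmissible e a b c d x y z) : a * (x * b - a) = b ^ 2 + c * d := by
  linear_combination -h.eq_x

theorem beta_mul (h : IsAdmissible e a b c d x y z) :
    d * (z * c - x * b + a) = a * c + b * e := by
  apply mul_left_cancel₀ h.a_pos.ne'
  linear_combination d * h.eq_x - h.eq_z

theorem vieta_pos (h : IsAdmissible e a b c d x y z) : 0 < x * z - y := by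
  have h1 : y * (x * z - y) = x ^ 2 + z ^ 2 + 7 := by linear_combination -h.markov
  exact pos_of_mul_pos_right (h1 ▸ by positivity) h.y_pos.le

theorem alpha (h : IsAdmissible e a b c d x y z) :
    IsAdmissible e b (x * b - a) c d x z (x * z - y) := by
  have hb := h.alpha_mul
  have hb_pos : 0 < x * b - a := by
    have := h.b_pos; have := h.c_pos; have := h.d_pos
    exact pos_of_mul_pos_right (hb ▸ by positivity) h.a_pos.le
  have hy : c ^ 2 * d + b ^ 2 * c + (x * b - a) ^ 2 * d + b * (x * b - a) * e =
      z * ((x * b - a) * c * d) := by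
    generalize x * b - a = b' at hb
    apply mul_left_cancel₀ h.a_pos.ne'
    linear_combination (b' * d - a * c) * hb + b' * h.eq_z
  exact
    { a_pos := h.b_pos
      b_pos := hb_pos
      c_pos := h.c_pos
      d_pos := h.d_pos
      x_pos := h.x_pos
      y_pos := h.z_pos
      z_pos := h.vieta_pos
      dvd_a := h.dvd_b
      dvd_b := (h.dvd_b.mul_left x).sub h.dvd_a
      dvd_c := h.dvd_c
      dvd_d := h.dvd_d
      eq_x := by linear_combination h.eq_x
      eq_y := hy
      eq_z := by linear_combination hy + h.eq_z - h.eq_y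
      markov := by linear_combination h.markov }

theorem beta (he : 0 < e) (h : IsAdmissible e a b c d x y z) :
    IsAdmissible e b c (z * c - x * b + a) a y z x := by
  have hf := h.beta_mul
  have hf_pos : 0 < z * c - x * b + a := by
    have := h.a_pos; have := h.b_pos; have := h.c_pos
    exact pos_of_mul_pos_right (hf ▸ by positivity) h.d_pos.le
  have hdvd : e ∣ z * c - x * b + a :=
    ((h.dvd_c.mul_left z).sub (h.dvd_b.mul_left x)).add h.dvd_a
  generalize z * c - x * b + a = f at hf hf_pos hdvd
  exact
    { a_pos := h.b_pos
      b_pos := h.c_pos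
      c_pos := hf_pos
      d_pos := h.a_pos
      x_pos := h.y_pos
      y_pos := h.z_pos
      z_pos := h.x_pos
      dvd_a := h.dvd_b
      dvd_b := h.dvd_c
      dvd_c := hdvd
      dvd_d := h.dvd_a
      eq_x := by
        apply mul_left_cancel₀ h.d_pos.ne'
        linear_combination a * hf + h.eq_y
      eq_y := by
        apply mul_left_cancel₀ h.d_pos.ne'
        linear_combination f * h.eq_z + (a * f - c * d) * hf
      eq_z := by
        apply mul_left_cancel₀ h.d_pos.ne'
        linear_combination d * f * h.eq_x - c * d * hf
      markov := by linear_combination h.markov }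

/-- A solution of the Markov-type equation that is not reduced by a Vieta jump in its largest
entry is a permutation of `(3, 4, 4)`. -/
theorem _root_.eq_of_markov_reduced {x y z : ℤ} (hx : 0 < x) (hxz : x ≤ z) (hzy : z ≤ y)
    (hred : 2 * y ≤ x * z) (h : x ^ 2 + y ^ 2 + z ^ 2 + 7 = x * y * z) :
    x = 3 ∧ y = 4 ∧ z = 4 := by
  have hz : 0 < z := hx.trans_le hxz
  have hy : 0 < y := hz.trans_le hzy
  have key : (x - 2) * z ^ 2 ≤ x ^ 2 + 7 := by
    nlinarith [mul_nonneg (sub_nonneg.2 hzy) (by linarith : 0 ≤ x * z - y - z)]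
  have hx3 : 3 ≤ x := by
    by_contra! hlt
    nlinarith [sq_nonneg (y - z), mul_pos hy hz, sq_nonneg x]
  have hx3' : x = 3 := by
    by_contra hne
    have : 4 ≤ x := by omega
    nlinarith [mul_le_mul hxz hxz hx.le hz.le, sq_nonneg z]
  subst hx3'
  have hz4 : z ≤ 4 := by nlinarith
  interval_cases z
  · nlinarith [sq_nonneg (2 * y - 9)]
  · have : (y - 4) * (y - 8) = 0 := by linear_combination h
    rcases mul_eq_zero.1 this with h | h <;> omega

theorem d_eq (h : IsAdmissible e a b c d 3 4 4) : d = c - 4 * (b - a) := by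
  apply mul_left_cancel₀ (mul_ne_zero h.c_pos.ne' h.d_pos.ne')
  linear_combination h.eq_z - h.eq_y

theorem e_eq (h : IsAdmissible e a b c d 3 4 4) : e = 8 * b - 3 * c - 4 * a := by
  have hf := h.beta_mul
  have hx := h.eq_x
  rw [h.d_eq] at hf hx
  apply mul_left_cancel₀ h.b_pos.ne'
  linear_combination 4 * hx - hf

theorem hyperbola (h : IsAdmissible e a b c d 3 4 4) :
    d * (9 * c - 3 * e - d) = c ^ 2 + e ^ 2 + 3 * e * c := by
  have hx := h.eq_x
  rw [h.d_eq] at hx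
  rw [h.e_eq, h.d_eq]
  linear_combination 16 * hx

end IsAdmissible

/-- The quintuple `(a, b, c, d, e)` lies in the orbit of `(e, e, e, e, e)`. -/
def InOrbit (e a b c d : ℤ) : Prop :=
  ∃ w : List Gen, applyWord w ((e : ℚ), (e : ℚ), (e : ℚ), (e : ℚ), (e : ℚ)) =
    ((a : ℚ), (b : ℚ), (c : ℚ), (d : ℚ), (e : ℚ))

theorem applyWord_append_singleton (w : List Gen) (g : Gen) (P : Q5) :
    applyWord (w ++ [g]) P = g.app (applyWord w P) := by
  simp [applyWord]

/-- The generator conjugate to `g` under the mirror symmetry, which is also its inverse. -/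
def Gen.mirror : Gen → Gen
  | .A => .Ainv
  | .B => .Binv
  | .Ainv => .A
  | .Binv => .B

def Q5.mirror : Q5 → Q5
  | (a, b, c, d, e) => (b, a, d, c, e)

theorem Gen.app_mirror (g : Gen) (P : Q5) : g.mirror.app P.mirror = (g.app P).mirror := by
  obtain ⟨a, b, c, d, e⟩ := P
  cases g <;>
    simp only [Gen.mirror, Gen.app, Q5.mirror, actAlpha, actAlphaInv, actBeta, actBetaInv] <;>
    ring_nf

theorem applyWord_mirror (w : List Gen) (P : Q5) :
    applyWord (w.map Gen.mirror) P.mirror = (applyWord w P).mirror := by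
  induction w generalizing P with
  | nil => rfl
  | cons g w ih =>
    change applyWord (w.map Gen.mirror) (g.mirror.app P.mirror) = (applyWord w (g.app P)).mirror
    rw [Gen.app_mirror, ih]

theorem InOrbit.mirror {e a b c d : ℤ} (h : InOrbit e a b c d) : InOrbit e b a d c := by
  obtain ⟨w, hw⟩ := h
  refine ⟨w.map Gen.mirror, ?_⟩
  have := applyWord_mirror w ((e : ℚ), (e : ℚ), (e : ℚ), (e : ℚ), (e : ℚ))
  rw [hw] at this
  exact this

namespace IsAdmissible

variable {e a b c d x y z : ℤ}

theorem actAlpha_eq (h : IsAdmissible e a b c d x y z) :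
    actAlpha (a, b, c, d, e) = ((b : ℚ), ((x * b - a : ℤ) : ℚ), (c : ℚ), (d : ℚ), (e : ℚ)) := by
  have ha : (a : ℚ) ≠ 0 := mod_cast h.a_pos.ne'
  have hmul : (a : ℚ) * ((x * b - a : ℤ) : ℚ) = b ^ 2 + c * d := mod_cast h.alpha_mul
  simp only [actAlpha]
  rw [← hmul, mul_div_cancel_left₀ _ ha]

theorem actBeta_eq (h : IsAdmissible e a b c d x y z) :
    actBeta (a, b, c, d, e) =
      ((b : ℚ), (c : ℚ), ((z * c - x * b + a : ℤ) : ℚ), (a : ℚ), (e : ℚ)) := by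
  have hd : (d : ℚ) ≠ 0 := mod_cast h.d_pos.ne'
  have hmul : (d : ℚ) * ((z * c - x * b + a : ℤ) : ℚ) = a * c + b * e := mod_cast h.beta_mul
  simp only [actBeta]
  rw [← hmul, mul_div_cancel_left₀ _ hd]

theorem inOrbit_of_alpha (h : IsAdmissible e a b c d x y z)
    (hr : InOrbit e b (x * b - a) c d) : InOrbit e a b c d := by
  obtain ⟨w, hw⟩ := hr
  refine ⟨w ++ [.Ainv], ?_⟩
  have hb : ((x * b - a : ℤ) : ℚ) ≠ 0 := mod_cast h.alpha.b_pos.ne'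
  have hmul : (a : ℚ) * ((x * b - a : ℤ) : ℚ) = b ^ 2 + c * d := mod_cast h.alpha_mul
  rw [applyWord_append_singleton, hw]
  simp only [Gen.app, actAlphaInv]
  rw [← hmul, mul_div_cancel_right₀ _ hb]

theorem inOrbit_of_beta (he : 0 < e) (h : IsAdmissible e a b c d x y z)
    (hr : InOrbit e b c (z * c - x * b + a) a) : InOrbit e a b c d := by
  obtain ⟨w, hw⟩ := hr
  refine ⟨w ++ [.Binv], ?_⟩
  have hf : ((z * c - x * b + a : ℤ) : ℚ) ≠ 0 := mod_cast (h.beta he).c_pos.ne'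
  have hmul : (d : ℚ) * ((z * c - x * b + a : ℤ) : ℚ) = b * e + c * a := by
    rw [add_comm (_ * _ : ℚ), mul_comm (c : ℚ)]
    exact_mod_cast h.beta_mul
  rw [applyWord_append_singleton, hw]
  simp only [Gen.app, actBetaInv]
  rw [← hmul, mul_div_cancel_right₀ _ hf]

/-- Descent along the conic of admissible quintuples over `(3, 4, 4)`, driven by the central
element `β³`. -/
theorem inOrbit_of_base (he : 0 < e) (h : IsAdmissible e a b c d 3 4 4) : InOrbit e a b c d := by
  induction hn : (c + d).toNat using Nat.strong_induction_on generalizing a b c d with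
  | _ n ih =>
    wlog hcd : c ≤ d generalizing a b c d
    · exact (this h.mirror (by rw [add_comm, hn]) (by omega)).mirror
    rcases hcd.eq_or_lt with rfl | hlt
    · have hab : a = b := by linarith [h.d_eq]
      subst hab
      have hac : (c - a) * (c + a) = 0 := by linear_combination h.eq_x
      have hca : c = a := by
        have := h.a_pos; have := h.c_pos
        rcases mul_eq_zero.1 hac with h | h <;> omega
      subst hca
      have hec : e = c := by linarith [h.e_eq]
      subst hec
      exact ⟨[], rfl⟩
    · have h1 := h.beta he
      have h2 := h1.beta he
      have h3 := h2.beta he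
      refine h.inOrbit_of_beta he (h1.inOrbit_of_beta he (h2.inOrbit_of_beta he ?_))
      refine ih _ ?_ h3 rfl
      have hc := h.c_pos
      have hec := Int.le_of_dvd hc h.dvd_c
      have hf : 4 * (3 * (4 * c - 3 * b + a) - 4 * c + b) - 4 * (4 * c - 3 * b + a) + c =
          9 * c - 3 * e - d := by
        linarith [h.d_eq, h.e_eq]
      have hlt' : 9 * c - 3 * e - d < d := by
        by_contra! hge
        have := h.hyperbola
        nlinarith [mul_pos (sub_pos.2 hlt) (sub_pos.2 (hlt.trans_le hge)),
          mul_nonneg (by linarith : 0 ≤ 7 * c + e) (sub_nonneg.2 hec)]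
      rw [hf]
      omega

theorem inOrbit (he : 0 < e) (h : IsAdmissible e a b c d x y z) : InOrbit e a b c d := by
  induction hn : (x + y + z).toNat using Nat.strong_induction_on
    generalizing a b c d x y z with
  | _ n ih =>
    have core : ∀ {a b c d x y z : ℤ}, IsAdmissible e a b c d x y z →
        (x + y + z).toNat = n → x ≤ y → z ≤ y → InOrbit e a b c d := by
      intro a b c d x y z h hn hxy hzy
      by_cases hred : x * z < 2 * y
      · refine h.inOrbit_of_alpha (ih _ ?_ h.alpha rfl)
        have := h.x_pos; have := h.y_pos; have := h.z_pos; have := h.vieta_pos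
        omega
      · push Not at hred
        rcases le_total x z with hxz | hzx
        · obtain ⟨rfl, rfl, rfl⟩ := eq_of_markov_reduced h.x_pos hxz hzy hred h.markov
          exact h.inOrbit_of_base he
        · obtain ⟨rfl, rfl, rfl⟩ := eq_of_markov_reduced h.z_pos hzx hxy
            (by linarith [mul_comm x z]) (by linear_combination h.markov)
          have h1 := h.beta he
          exact h.inOrbit_of_beta he (h1.inOrbit_of_beta he ((h1.beta he).inOrbit_of_base he))
    rcases le_total x y with hxy | hyx
    · rcases le_total z y with hzy | hyz
      · exact core h hn hxy hzy
      · exact (core h.mirror (by rw [← hn]; ring_nf) (hxy.trans hyz) hyz).mirror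
    · rcases le_total x z with hxz | hzx
      · exact (core h.mirror (by rw [← hn]; ring_nf) hxz (hyx.trans hxz)).mirror
      · refine h.inOrbit_of_beta he ?_
        exact (core (h.beta he).mirror (by rw [← hn]; ring_nf) hyx hzx).mirror

end IsAdmissible

/-- The rational quintuple `P` comes from an admissible integer quintuple. -/
def IsAdmissibleQ (e : ℤ) (P : Q5) : Prop :=
  ∃ a b c d x y z : ℤ, IsAdmissible e a b c d x y z ∧
    P = ((a : ℚ), (b : ℚ), (c : ℚ), (d : ℚ), (e : ℚ))

theorem IsAdmissibleQ.mirror {e : ℤ} {P : Q5} (h : IsAdmissibleQ e P) :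
    IsAdmissibleQ e P.mirror := by
  obtain ⟨a, b, c, d, x, y, z, h, rfl⟩ := h
  exact ⟨_, _, _, _, _, _, _, h.mirror, rfl⟩

theorem IsAdmissibleQ.app {e : ℤ} (he : 0 < e) {P : Q5} (h : IsAdmissibleQ e P) (g : Gen) :
    IsAdmissibleQ e (g.app P) := by
  have hA : ∀ {P : Q5}, IsAdmissibleQ e P → IsAdmissibleQ e (Gen.A.app P) := by
    rintro _ ⟨a, b, c, d, x, y, z, h, rfl⟩
    exact ⟨_, _, _, _, _, _, _, h.alpha, h.actAlpha_eq⟩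
  have hB : ∀ {P : Q5}, IsAdmissibleQ e P → IsAdmissibleQ e (Gen.B.app P) := by
    rintro _ ⟨a, b, c, d, x, y, z, h, rfl⟩
    exact ⟨_, _, _, _, _, _, _, h.beta he, h.actBeta_eq⟩
  cases g with
  | A => exact hA h
  | B => exact hB h
  | Ainv => exact (Gen.app_mirror .A P.mirror) ▸ (hA h.mirror).mirror
  | Binv => exact (Gen.app_mirror .B P.mirror) ▸ (hB h.mirror).mirror

theorem IsAdmissibleQ.word {e : ℤ} (he : 0 < e) (w : List Gen) {P : Q5}
    (h : IsAdmissibleQ e P) : IsAdmissibleQ e (applyWord w P) := by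
  induction w generalizing P with
  | nil => exact h
  | cons g w ih => exact ih (h.app he g)

theorem isAdmissible_diagonal {e : ℤ} (he : 0 < e) : IsAdmissible e e e e e 3 4 4 := by
  constructor <;> first | exact he | exact dvd_rfl | ring1 | norm_num

theorem T_eq_phi {a b c d : ℚ} (e : ℚ) (ha : a ≠ 0) (hb : b ≠ 0) (hc : c ≠ 0) (hd : d ≠ 0) :
    T (a, b, c, d, e) =
      phiC0 (a, b, c, d, e) * phiC1 (a, b, c, d, e) * phiC2 (a, b, c, d, e) -
        (phiC0 (a, b, c, d, e) ^ 2 + phiC1 (a, b, c, d, e) ^ 2 + phiC2 (a, b, c, d, e) ^ 2 + 7) := by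
  simp only [T, phiC0, phiC1, phiC2]
  field_simp
  ring

theorem inOrbit_iff {e : ℤ} (he : 0 < e) (P : Q5) :
    (∃ w : List Gen, applyWord w ((e : ℚ), (e : ℚ), (e : ℚ), (e : ℚ), (e : ℚ)) = P) ↔
      IsAdmissibleQ e P := by
  constructor
  · rintro ⟨w, rfl⟩
    exact IsAdmissibleQ.word he w ⟨e, e, e, e, 3, 4, 4, isAdmissible_diagonal he, rfl⟩
  · rintro ⟨a, b, c, d, x, y, z, h, rfl⟩
    exact h.inOrbit he

theorem isAdmissible_iff (e a b c d : ℕ) (ha : 0 < a) (hb : 0 < b) (hc : 0 < c) (hd : 0 < d)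
    (x y z : ℕ) (hx : 0 < x) (hy : 0 < y) (hz : 0 < z) :
    IsAdmissible e a b c d x y z ↔
      T ((a : ℚ), (b : ℚ), (c : ℚ), (d : ℚ), (e : ℚ)) = 0 ∧
      phiC0 ((a : ℚ), (b : ℚ), (c : ℚ), (d : ℚ), (e : ℚ)) = x ∧
      phiC1 ((a : ℚ), (b : ℚ), (c : ℚ), (d : ℚ), (e : ℚ)) = y ∧
      phiC2 ((a : ℚ), (b : ℚ), (c : ℚ), (d : ℚ), (e : ℚ)) = z ∧
      e ∣ a ∧ e ∣ b ∧ e ∣ c ∧ e ∣ d := by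
  have ha' : (a : ℚ) ≠ 0 := mod_cast ha.ne'
  have hb' : (b : ℚ) ≠ 0 := mod_cast hb.ne'
  have hc' : (c : ℚ) ≠ 0 := mod_cast hc.ne'
  have hd' : (d : ℚ) ≠ 0 := mod_cast hd.ne'
  rw [T_eq_phi _ ha' hb' hc' hd']
  have h0 : phiC0 ((a : ℚ), (b : ℚ), (c : ℚ), (d : ℚ), (e : ℚ)) = x ↔
      (a : ℤ) ^ 2 + b ^ 2 + c * d = x * (a * b) := by
    rw [phiC0, div_eq_iff (by positivity)]
    norm_cast
  have h1 : phiC1 ((a : ℚ), (b : ℚ), (c : ℚ), (d : ℚ), (e : ℚ)) = y ↔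
      (c : ℤ) ^ 2 * d + a ^ 2 * c + b ^ 2 * d + a * b * e = y * (b * c * d) := by
    rw [phiC1, div_eq_iff (by positivity)]
    norm_cast
  have h2 : phiC2 ((a : ℚ), (b : ℚ), (c : ℚ), (d : ℚ), (e : ℚ)) = z ↔
      (c : ℤ) * d ^ 2 + a ^ 2 * c + b ^ 2 * d + a * b * e = z * (a * c * d) := by
    rw [phiC2, div_eq_iff (by positivity)]
    norm_cast
  constructor
  · intro h
    have e0 := h0.2 h.eq_x
    have e1 := h1.2 h.eq_y
    have e2 := h2.2 h.eq_z
    refine ⟨?_, e0, e1, e2, Int.natCast_dvd_natCast.1 h.dvd_a, Int.natCast_dvd_natCast.1 h.dvd_b,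
      Int.natCast_dvd_natCast.1 h.dvd_c, Int.natCast_dvd_natCast.1 h.dvd_d⟩
    rw [e0, e1, e2, sub_eq_zero, eq_comm]
    exact_mod_cast h.markov
  · rintro ⟨hT, e0, e1, e2, da, db, dc, dd⟩
    rw [e0, e1, e2, sub_eq_zero, eq_comm] at hT
    exact
      { a_pos := mod_cast ha
        b_pos := mod_cast hb
        c_pos := mod_cast hc
        d_pos := mod_cast hd
        x_pos := mod_cast hx
        y_pos := mod_cast hy
        z_pos := mod_cast hz
        dvd_a := Int.natCast_dvd_natCast.2 da
        dvd_b := Int.natCast_dvd_natCast.2 db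
        dvd_c := Int.natCast_dvd_natCast.2 dc
        dvd_d := Int.natCast_dvd_natCast.2 dd
        eq_x := h0.1 e0
        eq_y := h1.1 e1
        eq_z := h2.1 e2
        markov := mod_cast hT }

/-- main theorem: the orbit G(ε,ε,ε,ε,ε) equals the set of quintuples
P = (a,b,c,d,ε) of positive integers with T(P) = 0, φ(P) ∈ ℕ₊³, and every component of P
divisible by ε. -/
theorem main_theorem (ε : ℕ) (hε : 0 < ε) :
    {P : Q5 | ∃ w : List Gen,
        applyWord w ((ε : ℚ), (ε : ℚ), (ε : ℚ), (ε : ℚ), (ε : ℚ)) = P} =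
    {P : Q5 | ∃ a b c d : ℕ, 0 < a ∧ 0 < b ∧ 0 < c ∧ 0 < d ∧
        P = ((a : ℚ), (b : ℚ), (c : ℚ), (d : ℚ), (ε : ℚ)) ∧
        T P = 0 ∧
        IsPosInt (phiC0 P) ∧ IsPosInt (phiC1 P) ∧ IsPosInt (phiC2 P) ∧
        ε ∣ a ∧ ε ∣ b ∧ ε ∣ c ∧ ε ∣ d} := by
  ext P
  have key := inOrbit_iff (e := (ε : ℤ)) (mod_cast hε) P
  simp only [Int.cast_natCast] at key
  rw [Set.mem_ofPred_eq, key, Set.mem_ofPred_eq]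
  constructor
  · rintro ⟨a, b, c, d, x, y, z, h, rfl⟩
    lift a to ℕ using h.a_pos.le
    lift b to ℕ using h.b_pos.le
    lift c to ℕ using h.c_pos.le
    lift d to ℕ using h.d_pos.le
    lift x to ℕ using h.x_pos.le
    lift y to ℕ using h.y_pos.le
    lift z to ℕ using h.z_pos.le
    have ha : 0 < a := mod_cast h.a_pos
    have hb : 0 < b := mod_cast h.b_pos
    have hc : 0 < c := mod_cast h.c_pos
    have hd : 0 < d := mod_cast h.d_pos
    have hx : 0 < x := mod_cast h.x_pos
    have hy : 0 < y := mod_cast h.y_pos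
    have hz : 0 < z := mod_cast h.z_pos
    obtain ⟨hT, h0, h1, h2, hdvd⟩ :=
      (isAdmissible_iff ε a b c d ha hb hc hd x y z hx hy hz).1 h
    simp only [Int.cast_natCast]
    exact ⟨a, b, c, d, ha, hb, hc, hd, rfl, hT, ⟨x, hx, h0⟩, ⟨y, hy, h1⟩, ⟨z, hz, h2⟩, hdvd⟩
  · rintro ⟨a, b, c, d, ha, hb, hc, hd, rfl, hT, ⟨x, hx, h0⟩, ⟨y, hy, h1⟩, ⟨z, hz, h2⟩, hdvd⟩
    exact ⟨a, b, c, d, x, y, z,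
      (isAdmissible_iff ε a b c d ha hb hc hd x y z hx hy hz).2 ⟨hT, h0, h1, h2, hdvd⟩,
      by simp only [Int.cast_natCast]⟩
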